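/- (Propagation of Maxwellian bounds) Let γ ∈ [-3,-2], T > 0 and μ, k, K > 0. Let g = (g_t)_{t∈[0,T]} be positive, C¹ in time and C² in velocity, solving pointwise the parabolic-form Landau equation ∂_t g = ā : ∇²g + c̄ g on (0,T]×ℝ³ (with coefficients ā, c̄ built from g itself), continuous on [0,T]×ℝ³, such that ∫ g_t = 1 for every t, sup_{t∈[0,T]} ‖g_t‖_{L^∞(ℝ³)} < ∞, sup_{t∈[0,T]} ∫ ⟨v⟩^p g_t < ∞ with p = γ(γ+2)/(γ+5) − γ, and such that at time zero k e^{−μ|v|²} ≤ g₀(v) ≤ K e^{−μ|v|²} for all v. Then there exist k', K' > 0 such that for all t ∈ [0,T] and all v ∈ ℝ³: k' e^{−μ|v|²} ≤ g_t(v) ≤ K' e^{−μ|v|²}. -/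

import Mathlib

noncomputable section

open MeasureTheory Real
open scoped ENNReal RealInnerProductSpace

/-- The velocity space ℝ³. -/
abbrev V3 : Type := EuclideanSpace ℝ (Fin 3)

/-- 3×3 real matrices. -/
abbrev Mat3 : Type := Matrix (Fin 3) (Fin 3) ℝ

/-- Japanese bracket ⟨v⟩ = √(1+|v|²). -/
def jap (v : V3) : ℝ := Real.sqrt (1 + ‖v‖ ^ 2)

/-- `i`-th basis vector of ℝ³. -/
def esingle (i : Fin 3) : V3 := EuclideanSpace.single i (1 : ℝ)

/-- Orthogonal projection Π(z) onto z^⊥. -/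
def proj (z : V3) : Mat3 := fun i j =>
  (if i = j then (1 : ℝ) else 0) - (z i / ‖z‖) * (z j / ‖z‖)

/-- Landau kernel a(z) = |z|^{γ+2} Π(z). -/
def landauKernel (γ : ℝ) (z : V3) : Mat3 := fun i j => ‖z‖ ^ (γ + 2) * proj z i j

/-- Cut-off kernel ã(z) = ⟨z⟩^γ |z|² Π(z). -/
def cutoffKernel (γ : ℝ) (z : V3) : Mat3 := fun i j => jap z ^ γ * ‖z‖ ^ 2 * proj z i j

/-- Bilinear form ⟨A w, z⟩. -/
def bilin (A : Mat3) (w z : V3) : ℝ := ∑ i, ∑ j, A i j * w i * z j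

/-- Quadratic form A : w^{⊗2}. -/
def quadForm (A : Mat3) (w : V3) : ℝ := bilin A w w

/-- Matrix dot product A : B. -/
def matDot (A B : Mat3) : ℝ := ∑ i, ∑ j, A i j * B i j

/-- (Frobenius) norm of a 3×3 matrix. -/
def matNorm (A : Mat3) : ℝ := Real.sqrt (∑ i, ∑ j, (A i j) ^ 2)

/-- Entropy H(f) = ∫ f ln f. -/
def entropy (f : V3 → ℝ) : ℝ := ∫ v, f v * Real.log (f v)

/-- Relative entropy H(f|g) = ∫ ((f/g) ln(f/g) − f/g + 1) g ∈ [0,∞]. -/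
def relEntropy (f g : V3 → ℝ) : ℝ≥0∞ :=
  ∫⁻ v, ENNReal.ofReal ((f v / g v * Real.log (f v / g v) - f v / g v + 1) * g v)

/-- Hessian matrix of a function on ℝ³. -/
def hess (φ : V3 → ℝ) (v : V3) : Mat3 := fun i j =>
  iteratedFDeriv ℝ 2 φ v ![esingle i, esingle j]

/-- Hessian matrix within a set. -/
def hessW (φ : V3 → ℝ) (s : Set V3) (v : V3) : Mat3 := fun i j =>
  iteratedFDerivWithin ℝ 2 φ s v ![esingle i, esingle j]

/-- Gradient of the logarithm, ∇ ln φ. -/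
def logGrad (φ : V3 → ℝ) (v : V3) : V3 := gradient (fun w => Real.log (φ w)) v

/-- Hessian of the logarithm, ∇² ln φ. -/
def logHess (φ : V3 → ℝ) (v : V3) : Mat3 := hess (fun w => Real.log (φ w)) v

/-- `G` is the weak gradient of `F` on ℝ⁶ ≃ ℝ³ × ℝ³. -/
def IsWeakGrad6 (F : V3 × V3 → ℝ) (G : V3 × V3 → V3 × V3) : Prop :=
  ∀ φ : V3 × V3 → ℝ, ContDiff ℝ (⊤ : ℕ∞) φ → HasCompactSupport φ →
    ∀ e : V3 × V3,
      (∫ p : V3 × V3, F p * fderiv ℝ φ p e) =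
        - ∫ p : V3 × V3, (⟪(G p).1, e.1⟫ + ⟪(G p).2, e.2⟫) * φ p

/-- `G` is the weak gradient of `F` on ℝ³. -/
def IsWeakGrad3 (F : V3 → ℝ) (G : V3 → V3) : Prop :=
  ∀ φ : V3 → ℝ, ContDiff ℝ (⊤ : ℕ∞) φ → HasCompactSupport φ →
    ∀ e : V3, (∫ v, F v * fderiv ℝ φ v e) = - ∫ v, ⟪G v, e⟫ * φ v

/-- Entropy production functional associated with a weak gradient of √(f f'). -/
def dissipation (γ : ℝ) (G : V3 × V3 → V3 × V3) : ℝ≥0∞ :=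
  ∫⁻ p : V3 × V3,
    ENNReal.ofReal (quadForm (landauKernel γ (p.1 - p.2)) ((G p).1 - (G p).2))

/-- Villani's H-solutions of the Landau equation on [0,T], with weak gradient data
`fGrad s` for √(f_s f_s'). -/
structure IsHSolution (γ T : ℝ) (f : ℝ → V3 → ℝ) (fGrad : ℝ → V3 × V3 → V3 × V3) : Prop where
  nonneg : ∀ t ∈ Set.Icc 0 T, ∀ v, 0 ≤ f t v
  integrable : ∀ t ∈ Set.Icc 0 T, Integrable (f t)
  entIntegrable : ∀ t ∈ Set.Icc 0 T, Integrable (fun v => f t v * Real.log (f t v))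
  contDistrib : ∀ φ : V3 → ℝ, ContDiff ℝ (⊤ : ℕ∞) φ → HasCompactSupport φ →
    ContinuousOn (fun t => ∫ v, φ v * f t v) (Set.Icc 0 T)
  mass : ∀ t ∈ Set.Icc 0 T, (∫ v, f t v) = 1
  momentumIntegrable : ∀ t ∈ Set.Icc 0 T, Integrable (fun v => f t v • v)
  momentum : ∀ t ∈ Set.Icc 0 T, (∫ v, f t v • v) = ∫ v, f 0 v • v
  energyIntegrable : ∀ t ∈ Set.Icc 0 T, Integrable (fun v => ‖v‖ ^ 2 * f t v)
  energy : ∀ t ∈ Set.Icc 0 T, (∫ v, ‖v‖ ^ 2 * f t v) = ∫ v, ‖v‖ ^ 2 * f 0 v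
  weakGrad : ∀ᵐ s ∂(volume.restrict (Set.Icc 0 T)),
    IsWeakGrad6 (fun p => Real.sqrt (f s p.1 * f s p.2)) (fGrad s)
  dissipationFinite : ∀ t ∈ Set.Icc 0 T,
    (∫⁻ s in Set.Ioc (0 : ℝ) t, dissipation γ (fGrad s)) < ⊤
  entropyProd : ∀ t ∈ Set.Icc 0 T,
    entropy (f t) + 2 * (∫⁻ s in Set.Ioc (0 : ℝ) t, dissipation γ (fGrad s)).toReal ≤
      entropy (f 0)
  weakForm : ∀ φ : ℝ → V3 → ℝ,
    ContDiff ℝ 2 (fun q : ℝ × V3 => φ q.1 q.2) →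
    HasCompactSupport (fun q : ℝ × V3 => φ q.1 q.2) →
    ∀ t ∈ Set.Icc 0 T,
      (∫ v, φ t v * f t v) - (∫ v, φ 0 v * f 0 v) =
        (∫ s in (0 : ℝ)..t, ∫ v, deriv (fun r => φ r v) s * f s v) -
          ∫ s in (0 : ℝ)..t, ∫ p : V3 × V3,
            bilin (landauKernel γ (p.1 - p.2))
              (gradient (φ s) p.1 - gradient (φ s) p.2)
              ((fGrad s p).1 - (fGrad s p).2) * Real.sqrt (f s p.1 * f s p.2)

/-- Convolved Landau matrix ā = a ⋆ f. -/
def abar (γ : ℝ) (f : V3 → ℝ) (v : V3) : Mat3 := fun i j =>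
  ∫ w, landauKernel γ (v - w) i j * f w

/-- Zero order coefficient c̄ of the Landau equation in nondivergence form. -/
def cbar (γ : ℝ) (f : V3 → ℝ) (v : V3) : ℝ :=
  if γ = -3 then 8 * Real.pi * f v else 2 * (γ + 3) * ∫ w, ‖v - w‖ ^ γ * f w

/-- Convolution of the cut-off kernel with a density. -/
def cutoffConv (γ : ℝ) (f : V3 → ℝ) (v : V3) : Mat3 := fun i j =>
  ∫ w, cutoffKernel γ (v - w) i j * f w

/-- Classical solution of the Landau equation on a time set `I`
(in nondivergence parabolic form ∂_t g = ā : ∇²g + c̄ g). -/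
structure IsClassicalSolution (γ : ℝ) (I : Set ℝ) (g : ℝ → V3 → ℝ) : Prop where
  pos : ∀ t ∈ I, ∀ v, 0 < g t v
  timeC1 : ∀ v, ContDiffOn ℝ 1 (fun t => g t v) I
  velC2 : ∀ t ∈ I, ContDiff ℝ 2 (g t)
  eqn : ∀ t ∈ I, ∀ v,
    derivWithin (fun s => g s v) I t =
      matDot (abar γ (g t) v) (hess (g t) v) + cbar γ (g t) v * g t v

/-- The moment exponent ρ = max(2κ, 2κ+2γ+4, 2ζ, ν). -/
def rhoExp (γ κ ζ ν : ℝ) : ℝ := max (max (2 * κ) (2 * κ + 2 * γ + 4)) (max (2 * ζ) ν)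

/-- Setting (⋆) of the paper. -/
structure Setting (γ T : ℝ) where
  f : ℝ → V3 → ℝ
  fGrad : ℝ → V3 × V3 → V3 × V3
  g : ℝ → V3 → ℝ
  κ : ℝ
  ν : ℝ
  ζ : ℝ
  K1 : ℝ → ℝ
  K2 : ℝ → ℝ
  K3 : ℝ → ℝ
  Mf : ℝ
  Mg : ℝ
  hγ : γ ∈ Set.Ico (-3 : ℝ) 0
  hT : 0 < T
  hf : IsHSolution γ T f fGrad
  hg : IsClassicalSolution γ (Set.Icc 0 T) g
  hκ : 1 ≤ κ
  hν : 1 ≤ ν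
  hζ : 0 ≤ ζ
  K1nonneg : ∀ t, 0 ≤ K1 t
  K2nonneg : ∀ t, 0 ≤ K2 t
  K3nonneg : ∀ t, 0 ≤ K3 t
  K1meas : Measurable K1
  K2meas : Measurable K2
  K3meas : Measurable K3
  K1bound : ∀ t ∈ Set.Icc 0 T, ∀ v, ‖logGrad (g t) v‖ ≤ K1 t * jap v ^ κ
  K2bound : ∀ t ∈ Set.Icc 0 T, ∀ v,
    |derivWithin (fun s => Real.log (g s v)) (Set.Icc 0 T) t| ≤ K2 t * jap v ^ ν
  K3bound : ∀ t ∈ Set.Icc 0 T, ∀ v, matNorm (logHess (g t) v) ≤ K3 t * jap v ^ ζ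
  Kint : IntegrableOn (fun t => K2 t + K1 t ^ 2 + K3 t ^ 2) (Set.Icc 0 T)
  fMomentInt : ∀ t ∈ Set.Icc 0 T,
    Integrable (fun v => jap v ^ (rhoExp γ κ ζ ν - γ) * f t v)
  fMoment : ∀ t ∈ Set.Icc 0 T, (∫ v, jap v ^ (rhoExp γ κ ζ ν - γ) * f t v) ≤ Mf
  gMomentInt : ∀ t ∈ Set.Icc 0 T,
    Integrable (fun v => jap v ^ (rhoExp γ κ ζ ν - γ) * g t v)
  gMoment : ∀ t ∈ Set.Icc 0 T, (∫ v, jap v ^ (rhoExp γ κ ζ ν - γ) * g t v) ≤ Mg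

/-- The good term 𝒢_s. -/
def goodTerm (γ : ℝ) (f g : ℝ → V3 → ℝ) (fGrad : ℝ → V3 × V3 → V3 × V3) (s : ℝ) : ℝ :=
  2 * ∫ p : V3 × V3,
    quadForm (landauKernel γ (p.1 - p.2))
      (((fGrad s p).1 - (fGrad s p).2) -
        Real.sqrt (f s p.1 * f s p.2) • (logGrad (g s) p.1 - logGrad (g s) p.2))

/-- The vector field a(v−v')(∇−∇')(g g'). -/
def landauFlux (γ : ℝ) (g : V3 → ℝ) (v w : V3) : Fin 3 → ℝ := fun i =>
  ∑ j, landauKernel γ (v - w) i j * (g w * (gradient g v) j - g v * (gradient g w) j)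

/-- (∇−∇')·[a(v−v')(∇−∇')(g g')]. -/
def divDiffFlux (γ : ℝ) (g : V3 → ℝ) (v w : V3) : ℝ :=
  ∑ i, (fderiv ℝ (fun z => landauFlux γ g z w i) v (esingle i) -
        fderiv ℝ (fun z => landauFlux γ g v z i) w (esingle i))

/-- The bad term ℬ_s. -/
def badTerm (γ : ℝ) (f g : ℝ → V3 → ℝ) (s : ℝ) : ℝ :=
  (1 / 2) * ∫ p : V3 × V3,
    (f s p.1 - g s p.1) * (f s p.2 - g s p.2) / (g s p.1 * g s p.2) *
      divDiffFlux γ (g s) p.1 p.2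

/-- Weighted relative Fisher information ∫ |2∇√f − √f ∇ln g|² ⟨v⟩^γ dv. -/
def relFisher (γ : ℝ) (f g : V3 → ℝ) (fGrad3 : V3 → V3) : ℝ :=
  ∫ v, ‖(2 : ℝ) • fGrad3 v - Real.sqrt (f v) • logGrad g v‖ ^ 2 * jap v ^ γ

/-- ‖⟨v⟩^{−κ} ∇ ln g_s‖_{L^∞(ℝ³)} ∈ [0,∞]. -/
def gradLogSup (g : ℝ → V3 → ℝ) (κ s : ℝ) : ℝ≥0∞ :=
  ⨆ v : V3, ENNReal.ofReal (jap v ^ (-κ) * ‖logGrad (g s) v‖)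

/-- ‖⟨v⟩^{−ν} ∂_s ln g_s‖_{L^∞(ℝ³)} ∈ [0,∞]. -/
def dtLogSup (g : ℝ → V3 → ℝ) (T ν s : ℝ) : ℝ≥0∞ :=
  ⨆ v : V3, ENNReal.ofReal
    (jap v ^ (-ν) * |derivWithin (fun r => Real.log (g r v)) (Set.Icc 0 T) s|)

/-- ‖⟨v⟩^{−ζ} ∇² ln g_s‖_{L^∞(ℝ³)} ∈ [0,∞]. -/
def hessLogSup (g : ℝ → V3 → ℝ) (ζ s : ℝ) : ℝ≥0∞ :=
  ⨆ v : V3, ENNReal.ofReal (jap v ^ (-ζ) * matNorm (logHess (g s) v))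

/-- Open cube Σ_R(v₀) = v₀ + (−R,R)³. -/
def cube (v₀ : V3) (R : ℝ) : Set V3 := {v | ∀ i, |v i - v₀ i| < R}

/-- Closed cube v₀ + [−R,R]³ centered at the origin. -/
def ccube (R : ℝ) : Set V3 := {v | ∀ i, |v i| ≤ R}

/-- Distance to the boundary of the cube Σ_R(v₀). -/
def dCube (v₀ : V3) (R : ℝ) (v : V3) : ℝ :=
  Finset.univ.inf' (Finset.univ_nonempty) fun i : Fin 3 => R - |v i - v₀ i|

/-- The moment exponent k(γ,ℓ,δ) of Theorem 2. -/
def kExp (γ ℓ δ : ℝ) : ℝ := 8 * (max (2 + (ℓ - 2) / (2 + δ)) 1 + (2 - γ) / (2 * δ)) - γ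


lemma ker_integrable (a : ℝ) (ha : -3 < a) :
    Integrable (fun z : V3 => if ‖z‖ < 1 then ‖z‖ ^ a else 0) := by
  have h := (MeasureTheory.integrable_fun_norm_addHaar (E := V3) (volume : Measure V3)
    (f := fun r : ℝ => if r < 1 then r ^ a else 0))
  rw [h]
  have h2 : IntegrableOn (fun y : ℝ => y ^ (2 + a)) (Set.Ioo 0 1) := by
    rw [intervalIntegral.integrableOn_Ioo_rpow_iff one_pos]
    linarith
  have h3 : IntegrableOn (fun y : ℝ => (Set.Ioo (0:ℝ) 1).indicator (fun y : ℝ => y ^ (2 + a)) y) (Set.Ioi 0) := by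
    apply Integrable.integrableOn
    rwa [integrable_indicator_iff measurableSet_Ioo]
  refine h3.congr_fun ?_ measurableSet_Ioi
  intro y hy
  have hy' : (0:ℝ) < y := hy
  simp only [Set.indicator, Set.mem_Ioo, hy', true_and, finrank_euclideanSpace, Fintype.card_fin]
  split_ifs with h1
  · rw [Real.rpow_add hy']; simp
  · simp

lemma jap_ge_one (v : V3) : 1 ≤ jap v := by
  unfold jap
  rw [Real.one_le_sqrt]
  nlinarith [sq_nonneg ‖v‖]

lemma jap_sq (v : V3) : jap v ^ 2 = 1 + ‖v‖ ^ 2 := by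
  unfold jap
  rw [Real.sq_sqrt]; positivity

lemma jap_meas : Measurable jap := by
  unfold jap
  fun_prop

lemma pow_bound (a r : ℝ) (ha : a ≤ 0) :
    r ^ a ≤ 1 + (if r < 1 then r ^ a else 0) := by
  split_ifs with h
  · linarith
  · have := Real.rpow_le_one_of_one_le_of_nonpos (not_lt.mp h) ha
    linarith

lemma quad_bound (γ r j : ℝ) (hγ : γ ∈ Set.Icc (-3 : ℝ) (-2)) (hr : 0 < r) (hj : 1 ≤ j) :
    r ^ (γ + 2) * j ^ 2 ≤ j ^ (γ * (γ + 2) / (γ + 5) - γ)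
      + (if r < 1 then r ^ (3 * γ / 5) else 0) := by
  obtain ⟨h1, h2⟩ := hγ
  have hj0 : 0 < j := by linarith
  have h5 : 0 < γ + 5 := by linarith
  set p := γ * (γ + 2) / (γ + 5) - γ with hp
  have hp' : p = 2 + (5 / (γ + 5)) * (-(γ + 2)) := by
    rw [hp]; field_simp; ring
  have hs : 0 < 5 / (γ + 5) := by positivity
  have hp2 : 2 ≤ p := by
    rw [hp']
    have := mul_nonneg hs.le (show 0 ≤ -(γ + 2) by linarith)
    linarith
  have hjp : j ^ (2:ℝ) ≤ j ^ p := Real.rpow_le_rpow_of_exponent_le hj hp2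
  rw [← Real.rpow_natCast j 2]
  push_cast
  split_ifs with h
  · by_cases hc : r * j ^ (5 / (γ + 5)) ≤ 1
    · have e1 : j ≤ r ^ (-((γ + 5) / 5)) := by
        have : j ^ (5 / (γ + 5)) ≤ r⁻¹ := by
          rw [le_inv_comm₀ (by positivity) hr]
          rw [← one_div, le_div_iff₀ (by positivity)]; exact hc
        have h3 := Real.rpow_le_rpow (by positivity) this (show 0 ≤ (γ + 5) / 5 by positivity)
        rw [← Real.rpow_mul hj0.le, Real.inv_rpow hr.le, ← Real.rpow_neg hr.le] at h3
        have : 5 / (γ + 5) * ((γ + 5) / 5) = 1 := by field_simp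
        rwa [this, Real.rpow_one] at h3
      have e2 : j ^ (2:ℝ) ≤ r ^ (-(2 * ((γ + 5) / 5))) := by
        have h3 := Real.rpow_le_rpow hj0.le e1 (show (0:ℝ) ≤ 2 by norm_num)
        rw [← Real.rpow_mul hr.le] at h3
        convert h3 using 2; ring
      have e3 : r ^ (3 * γ / 5) = r ^ (γ + 2) * r ^ (-(2 * ((γ + 5) / 5))) := by
        rw [← Real.rpow_add hr]; congr 1; ring
      have : 0 < j ^ p := by positivity
      rw [e3]
      have := mul_le_mul_of_nonneg_left e2 (show 0 ≤ r ^ (γ+2) by positivity)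
      linarith
    · push Not at hc
      have e1 : r⁻¹ ≤ j ^ (5 / (γ + 5)) := by
        rw [← one_div, div_le_iff₀ hr]; linarith
      have h3 := Real.rpow_le_rpow (by positivity) e1 (show 0 ≤ -(γ + 2) by linarith)
      rw [← Real.rpow_mul hj0.le, Real.inv_rpow hr.le, ← Real.rpow_neg hr.le, neg_neg] at h3
      have : j ^ p = j ^ (5 / (γ + 5) * -(γ + 2)) * j ^ (2:ℝ) := by
        rw [← Real.rpow_add hj0, hp']; congr 1; ring
      rw [this]
      have := mul_le_mul_of_nonneg_right h3 (show 0 ≤ j ^ (2:ℝ) by positivity)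
      have : 0 ≤ r ^ (3 * γ / 5) := by positivity
      linarith
  · have := Real.rpow_le_one_of_one_le_of_nonpos (not_lt.mp h) (show γ + 2 ≤ 0 by linarith)
    have h3 := mul_le_mul_of_nonneg_right this (show 0 ≤ j ^ (2:ℝ) by positivity)
    linarith

/-- Generic bound for convolution-like integrals. -/
lemma conv_bound (a p B M : ℝ) (ha : -3 < a) (f : V3 → ℝ) (hf : ∀ w, 0 < f w) (hB : ∀ w, f w ≤ B)
    (hfm : AEStronglyMeasurable f volume)
    (hM : Integrable (fun w => jap w ^ p * f w)) (hM' : (∫ w, jap w ^ p * f w) ≤ M)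
    (v : V3) (q : V3 → ℝ) (hq : AEStronglyMeasurable q volume) (c : ℝ) (hc : 0 ≤ c)
    (hqb : ∀ᵐ w, |q w| ≤ c * (jap w ^ p + (if ‖v - w‖ < 1 then ‖v - w‖ ^ a else 0))) :
    Integrable (fun w => q w * f w) ∧
      (∫ w, q w * f w) ≤ c * (M + B * ∫ z : V3, (if ‖z‖ < 1 then ‖z‖ ^ a else 0)) := by
  set k : V3 → ℝ := fun z => if ‖z‖ < 1 then ‖z‖ ^ a else 0 with hk
  have hk0 : ∀ z, 0 ≤ k z := by
    intro z; simp only [hk]; split_ifs <;> positivity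
  have hkI : Integrable k := ker_integrable a ha
  have hkv : Integrable (fun w => k (v - w)) := hkI.comp_sub_left v
  have hkv' : ∫ w, k (v - w) = ∫ z, k z := integral_sub_left_eq_self k volume v
  have hdom : Integrable (fun w => c * (jap w ^ p * f w + B * k (v - w))) :=
    (hM.add (hkv.const_mul B)).const_mul c
  have hle : ∀ᵐ w, |q w * f w| ≤ c * (jap w ^ p * f w + B * k (v - w)) := by
    filter_upwards [hqb] with w hw
    rw [abs_mul, abs_of_pos (hf w)]
    have h1 := mul_le_mul_of_nonneg_right hw (hf w).le
    have h2 := mul_le_mul_of_nonneg_right (hB w) (hk0 (v - w))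
    have h3 := mul_le_mul_of_nonneg_left h2 hc
    have : (if ‖v - w‖ < 1 then ‖v - w‖ ^ a else 0) = k (v - w) := rfl
    rw [this] at h1
    nlinarith
  have hI : Integrable (fun w => q w * f w) := by
    refine hdom.mono' (hq.mul hfm) ?_
    filter_upwards [hle] with w hw
    exact hw
  refine ⟨hI, ?_⟩
  calc (∫ w, q w * f w) ≤ ∫ w, c * (jap w ^ p * f w + B * k (v - w)) := by
        apply integral_mono_ae hI hdom
        filter_upwards [hle] with w hw
        exact (le_abs_self _).trans hw
    _ = c * ((∫ w, jap w ^ p * f w) + B * ∫ z, k z) := by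
        rw [integral_const_mul, integral_add hM (hkv.const_mul B), integral_const_mul, hkv']
    _ ≤ _ := by gcongr

lemma proj_idem (z : V3) (i j : Fin 3) :
    proj z i j = ∑ l, proj z i l * proj z j l := by
  by_cases hz : z = 0
  · subst hz
    fin_cases i <;> fin_cases j <;> simp [proj]
  · have hz' : ‖z‖ ≠ 0 := norm_ne_zero_iff.mpr hz
    have hS : (z 0 / ‖z‖) ^ 2 + (z 1 / ‖z‖) ^ 2 + (z 2 / ‖z‖) ^ 2 = 1 := by
      have := EuclideanSpace.real_norm_sq_eq z
      rw [Fin.sum_univ_three] at this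
      field_simp
      linarith
    have key : ∀ a b c : ℝ, ∀ i j : Fin 3, a ^ 2 + b ^ 2 + c ^ 2 = 1 →
        ((if i = j then (1 : ℝ) else 0) - (![a, b, c] i) * (![a, b, c] j)) =
        ∑ l, ((if i = l then (1 : ℝ) else 0) - (![a, b, c] i) * (![a, b, c] l)) *
          ((if j = l then (1 : ℝ) else 0) - (![a, b, c] j) * (![a, b, c] l)) := by
      intro a b c i j h
      fin_cases i <;> fin_cases j <;> simp [Fin.sum_univ_three] <;> grind
    have hn : ∀ i, ![z 0 / ‖z‖, z 1 / ‖z‖, z 2 / ‖z‖] i = z i / ‖z‖ := by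
      intro i; fin_cases i <;> rfl
    have := key _ _ _ i j hS
    simp only [hn] at this
    exact this

lemma proj_abs (z : V3) (i j : Fin 3) : |proj z i j| ≤ 2 := by
  have hn : ∀ i, |z i / ‖z‖| ≤ 1 := by
    intro i
    rw [abs_div, abs_norm]
    apply div_le_one_of_le₀ _ (norm_nonneg _)
    have := PiLp.norm_apply_le z i
    simpa using this
  unfold proj
  have h1 : |(z i / ‖z‖) * (z j / ‖z‖)| ≤ 1 := by
    rw [abs_mul]
    exact mul_le_one₀ (hn i) (abs_nonneg _) (hn j)
  rw [abs_le] at h1 ⊢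
  split_ifs <;> constructor <;> linarith [h1.1, h1.2]

lemma proj_nonpos (z : V3) (H : Mat3)
    (hH : ∀ x : V3, ∑ i, ∑ j, H i j * x i * x j ≤ 0) : matDot (proj z) H ≤ 0 := by
  have : matDot (proj z) H =
      ∑ l, ∑ i, ∑ j, H i j * (WithLp.toLp 2 (fun i => proj z i l) : V3) i *
        (WithLp.toLp 2 (fun i => proj z i l) : V3) j := by
    unfold matDot
    rw [Finset.sum_comm]
    rw [Finset.sum_comm]
    conv_rhs => rw [Finset.sum_comm]
    refine Finset.sum_congr rfl fun i _ => ?_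
    conv_rhs => rw [Finset.sum_comm]
    refine Finset.sum_congr rfl fun j _ => ?_
    rw [proj_idem, Finset.sum_mul]
    refine Finset.sum_congr rfl fun l _ => ?_
    simp only
    ring
  rw [this]
  exact Finset.sum_nonpos fun l _ => hH _

def idm : Mat3 := fun i j => if i = j then 1 else 0
def vvm (v : V3) : Mat3 := fun i j => v i * v j

lemma matDot_neg (A H : Mat3) : matDot A (-H) = - matDot A H := by
  simp [matDot, Matrix.neg_apply, Finset.sum_neg_distrib]

lemma proj_nonneg (z : V3) (H : Mat3)
    (hH : ∀ x : V3, 0 ≤ ∑ i, ∑ j, H i j * x i * x j) : 0 ≤ matDot (proj z) H := by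
  have := proj_nonpos z (-H) (by
    intro x
    have := hH x
    simp only [Matrix.neg_apply, neg_mul, Finset.sum_neg_distrib]
    linarith)
  rw [matDot_neg] at this
  linarith

lemma idm_pos (x : V3) : 0 ≤ ∑ i, ∑ j, idm i j * x i * x j := by
  simp [idm, Fin.sum_univ_three]
  nlinarith [sq_nonneg (x 0), sq_nonneg (x 1), sq_nonneg (x 2)]

lemma vvm_pos (v x : V3) : 0 ≤ ∑ i, ∑ j, vvm v i j * x i * x j := by
  have : ∑ i, ∑ j, vvm v i j * x i * x j = (∑ i, v i * x i) ^ 2 := by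
    simp [vvm, Fin.sum_univ_three]; ring
  rw [this]; positivity

lemma proj_idm_le (z : V3) : matDot (proj z) idm ≤ 3 := by
  simp only [matDot, idm, proj, Fin.sum_univ_three]
  simp
  nlinarith [mul_self_nonneg (z 0 / ‖z‖), mul_self_nonneg (z 1 / ‖z‖), mul_self_nonneg (z 2 / ‖z‖)]

lemma proj_vvm_le (v w : V3) (h : v ≠ w) : matDot (proj (v - w)) (vvm v) ≤ ‖w‖ ^ 2 := by
  have hz' : ‖v - w‖ ≠ 0 := norm_ne_zero_iff.mpr (sub_ne_zero.mpr h)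
  have h1 := EuclideanSpace.real_norm_sq_eq (v - w)
  have h2 := EuclideanSpace.real_norm_sq_eq w
  rw [Fin.sum_univ_three] at h1 h2
  have hS : ((v - w) 0 / ‖v - w‖) ^ 2 + ((v - w) 1 / ‖v - w‖) ^ 2 + ((v - w) 2 / ‖v - w‖) ^ 2 = 1 := by
    field_simp
    linarith
  have hv : ∀ i, v i = w i + ‖v - w‖ * ((v - w) i / ‖v - w‖) := by
    intro i
    field_simp
    simp
  rw [h2]
  have key : ∀ a b c r x y z : ℝ, a ^ 2 + b ^ 2 + c ^ 2 = 1 →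
     (x + r * a) ^ 2 + (y + r * b) ^ 2 + (z + r * c) ^ 2 -
       (a * (x + r * a) + b * (y + r * b) + c * (z + r * c)) ^ 2 ≤ x ^ 2 + y ^ 2 + z ^ 2 := by
    intro a b c r x y z h
    have : (a * (x + r * a) + b * (y + r * b) + c * (z + r * c)) = (a * x + b * y + c * z) + r := by
      linear_combination r * h
    rw [this]
    have e : (x + r * a) ^ 2 + (y + r * b) ^ 2 + (z + r * c) ^ 2 =
        x ^ 2 + y ^ 2 + z ^ 2 + 2 * r * (a * x + b * y + c * z) + r ^ 2 := by
      linear_combination r ^ 2 * h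
    rw [e]
    nlinarith [sq_nonneg (a * x + b * y + c * z)]
  have hk := key _ _ _ ‖v - w‖ (w 0) (w 1) (w 2) hS
  rw [← hv 0, ← hv 1, ← hv 2] at hk
  refine le_trans (le_of_eq ?_) hk
  unfold matDot vvm proj
  generalize (v - w) = z
  simp only [Fin.sum_univ_three]
  simp
  ring

lemma proj_meas (v : V3) (i j : Fin 3) : Measurable (fun w : V3 => proj (v - w) i j) := by
  unfold proj
  have : ∀ i, Measurable (fun w : V3 => (v - w) i / ‖v - w‖) := by
    intro i
    have h1 : Measurable (fun w : V3 => (v - w) i) := by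
      have : Continuous (fun w : V3 => (v - w) i) := by fun_prop
      exact this.measurable
    exact h1.div (by fun_prop)
  exact (measurable_const).sub ((this i).mul (this j))

lemma matDot_proj_meas (v : V3) (H : Mat3) : Measurable (fun w : V3 => matDot (proj (v - w)) H) := by
  unfold matDot
  refine Finset.measurable_sum _ fun i _ => Finset.measurable_sum _ fun j _ => ?_
  exact (proj_meas v i j).mul_const _

lemma normpow_meas (v : V3) (a : ℝ) : Measurable (fun w : V3 => ‖v - w‖ ^ a) := by
  have : Measurable (fun w : V3 => ‖v - w‖) := by fun_prop
  exact this.pow_const a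

lemma matDot_sub (A H E : Mat3) : matDot A (H - E) = matDot A H - matDot A E := by
  simp [matDot, Matrix.sub_apply, mul_sub, Finset.sum_sub_distrib]
lemma matDot_add (A H E : Mat3) : matDot A (H + E) = matDot A H + matDot A E := by
  simp [matDot, Matrix.add_apply, mul_add, Finset.sum_add_distrib]
lemma matDot_smul (c : ℝ) (A H : Mat3) : matDot A (c • H) = c * matDot A H := by
  simp [matDot, Matrix.smul_apply, Finset.mul_sum]
  refine Finset.sum_congr rfl fun i _ => Finset.sum_congr rfl fun j _ => by ring

lemma abar_eq (γ B : ℝ) (hγ : γ ∈ Set.Icc (-3 : ℝ) (-2)) (f : V3 → ℝ) (hf : ∀ w, 0 < f w)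
    (hB : ∀ w, f w ≤ B) (hfi : Integrable f) (v : V3) (H : Mat3) :
    matDot (abar γ f v) H = ∫ w, (‖v - w‖ ^ (γ + 2) * matDot (proj (v - w)) H) * f w := by
  obtain ⟨h1, h2⟩ := hγ
  have hI : ∀ i j, Integrable (fun w => landauKernel γ (v - w) i j * f w) := by
    intro i j
    refine (conv_bound (γ + 2) 0 B _ (by linarith) f hf hB hfi.aestronglyMeasurable
      (by simpa using hfi) le_rfl v _ ?_ 2 (by norm_num) ?_).1
    · exact ((normpow_meas v (γ + 2)).mul (proj_meas v i j)).aestronglyMeasurable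
    · refine Filter.Eventually.of_forall fun w => ?_
      have := pow_bound (γ + 2) ‖v - w‖ (by linarith)
      have h3 := proj_abs (v - w) i j
      have h4 : 0 ≤ ‖v - w‖ ^ (γ + 2) := by positivity
      rw [landauKernel, abs_mul, abs_of_nonneg h4, Real.rpow_zero]
      nlinarith [abs_nonneg (proj (v - w) i j)]
  unfold matDot
  simp only [abar]
  simp_rw [Finset.mul_sum, Finset.sum_mul]
  rw [integral_finsetSum]
  · refine Finset.sum_congr rfl fun i _ => ?_
    rw [integral_finsetSum]
    · refine Finset.sum_congr rfl fun j _ => ?_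
      rw [← integral_mul_const]
      congr 1; ext w
      simp only [landauKernel]; ring
    · intro j _
      refine ((hI i j).mul_const (H i j)).congr (Filter.Eventually.of_forall fun w => ?_)
      simp only [landauKernel]; ring
  · intro i _
    refine integrable_finsetSum _ fun j _ => ?_
    refine ((hI i j).mul_const (H i j)).congr (Filter.Eventually.of_forall fun w => ?_)
    simp only [landauKernel]; ring

/-- All the information about the coefficients. -/
lemma coeff_bounds (γ B M : ℝ) (hγ : γ ∈ Set.Icc (-3 : ℝ) (-2)) :
    ∃ C : ℝ, 0 ≤ C ∧ ∀ f : V3 → ℝ, (∀ w, 0 < f w) → (∀ w, f w ≤ B) → Integrable f →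
      (∫ w, f w) = 1 →
      Integrable (fun v => jap v ^ (γ * (γ + 2) / (γ + 5) - γ) * f v) →
      (∫ v, jap v ^ (γ * (γ + 2) / (γ + 5) - γ) * f v) ≤ M → ∀ v : V3,
      (∀ H : Mat3, (∀ x : V3, ∑ i, ∑ j, H i j * x i * x j ≤ 0) → matDot (abar γ f v) H ≤ 0) ∧
      matDot (abar γ f v) idm ≤ C ∧ 0 ≤ matDot (abar γ f v) idm ∧
      matDot (abar γ f v) (vvm v) ≤ C ∧ 0 ≤ matDot (abar γ f v) (vvm v) ∧
      0 ≤ cbar γ f v ∧ cbar γ f v ≤ C := by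
  have hγ' := hγ
  obtain ⟨h1, h2⟩ := hγ
  set C1 := 3 * (1 + B * ∫ z : V3, (if ‖z‖ < 1 then ‖z‖ ^ (γ + 2) else 0))
  set C2 := 1 * (M + B * ∫ z : V3, (if ‖z‖ < 1 then ‖z‖ ^ (3 * γ / 5) else 0))
  set C3 := 1 * (1 + B * ∫ z : V3, (if ‖z‖ < 1 then ‖z‖ ^ γ else 0))
  set C4 := 8 * Real.pi * B
  refine ⟨|C1| + |C2| + |2 * (γ + 3) * C3| + |C4|, by positivity, ?_⟩
  intro f hf hB hfi hm hmi hmM v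
  have a1 := abs_nonneg C1
  have a2 := abs_nonneg C2
  have a3 := abs_nonneg (2 * (γ + 3) * C3)
  have a4 := abs_nonneg C4
  have l1 := le_abs_self C1
  have l2 := le_abs_self C2
  have l3 := le_abs_self (2 * (γ + 3) * C3)
  have l4 := le_abs_self C4
  have hne : ∀ᵐ w : V3, v ≠ w := by
    have : ∀ᵐ w : V3, w ∈ ({v} : Set V3)ᶜ := compl_mem_ae_iff.mpr (measure_singleton v)
    filter_upwards [this] with w hw
    exact fun h => hw h.symm
  have hae := fun H => abar_eq γ B hγ' f hf hB hfi v H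
  refine ⟨?_, ?_, ?_, ?_, ?_, ?_⟩
  · intro H hH
    rw [hae]
    refine integral_nonpos fun w => ?_
    have := proj_nonpos (v - w) H hH
    have h4 : 0 ≤ ‖v - w‖ ^ (γ + 2) := by positivity
    exact mul_nonpos_of_nonpos_of_nonneg (mul_nonpos_of_nonneg_of_nonpos h4 this) (hf w).le
  · rw [hae]
    have := (conv_bound (γ + 2) 0 B 1 (by linarith) f hf hB hfi.aestronglyMeasurable
      (by simpa using hfi) (by simpa using hm.le) v
      (fun w => ‖v - w‖ ^ (γ + 2) * matDot (proj (v - w)) idm)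
      ((normpow_meas v (γ + 2)).mul (matDot_proj_meas v idm)).aestronglyMeasurable
      3 (by norm_num) ?_).2
    · linarith
    · refine Filter.Eventually.of_forall fun w => ?_
      have := pow_bound (γ + 2) ‖v - w‖ (by linarith)
      have h3 := proj_idm_le (v - w)
      have h5 := proj_nonneg (v - w) idm idm_pos
      have h4 : 0 ≤ ‖v - w‖ ^ (γ + 2) := by positivity
      rw [abs_of_nonneg (mul_nonneg h4 h5), Real.rpow_zero]
      nlinarith
  · rw [hae]
    refine integral_nonneg fun w => ?_
    have h5 := proj_nonneg (v - w) idm idm_pos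
    have := (hf w).le
    positivity
  · rw [hae]
    have := (conv_bound (3 * γ / 5) _ B M (by linarith) f hf hB hfi.aestronglyMeasurable
      hmi hmM v
      (fun w => ‖v - w‖ ^ (γ + 2) * matDot (proj (v - w)) (vvm v))
      ((normpow_meas v (γ + 2)).mul (matDot_proj_meas v _)).aestronglyMeasurable
      1 (by norm_num) ?_).2
    · linarith
    · filter_upwards [hne] with w hw
      have hz : 0 < ‖v - w‖ := norm_pos_iff.mpr (sub_ne_zero.mpr hw)
      have := quad_bound γ ‖v - w‖ (jap w) hγ' hz (jap_ge_one w)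
      have h3 := proj_vvm_le v w hw
      have h5 := proj_nonneg (v - w) (vvm v) (vvm_pos v)
      have h4 : 0 ≤ ‖v - w‖ ^ (γ + 2) := by positivity
      have h6 := jap_sq w
      rw [abs_of_nonneg (mul_nonneg h4 h5)]
      nlinarith
  · rw [hae]
    refine integral_nonneg fun w => ?_
    have h5 := proj_nonneg (v - w) (vvm v) (vvm_pos v)
    have := (hf w).le
    positivity
  · unfold cbar
    split_ifs with h
    · have := hf v
      have hb := hB v
      constructor
      · positivity
      · have : 8 * Real.pi * f v ≤ C4 := mul_le_mul_of_nonneg_left hb (by positivity)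
        linarith
    · have h3 : -3 < γ := lt_of_le_of_ne h1 (Ne.symm h)
      have h30 : 0 ≤ 2 * (γ + 3) := by linarith
      constructor
      · refine mul_nonneg h30 (integral_nonneg fun w => ?_)
        have := (hf w).le
        positivity
      · have := (conv_bound γ 0 B 1 h3 f hf hB hfi.aestronglyMeasurable
          (by simpa using hfi) (by simpa using hm.le) v
          (fun w => ‖v - w‖ ^ γ) (normpow_meas v γ).aestronglyMeasurable
          1 (by norm_num) ?_).2
        · have := mul_le_mul_of_nonneg_left this h30
          linarith
        · refine Filter.Eventually.of_forall fun w => ?_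
          have := pow_bound γ ‖v - w‖ (by linarith)
          have h4 : 0 ≤ ‖v - w‖ ^ γ := by positivity
          rw [abs_of_nonneg h4, Real.rpow_zero]
          linarith

lemma sec_test (F F' : ℝ → ℝ) (d : ℝ) (h1 : ∀ s, HasDerivAt F (F' s) s)
    (h2 : HasDerivAt F' d 0) (hmax : ∀ s, F s ≤ F 0) : d ≤ 0 := by
  by_contra hd
  push Not at hd
  have hdF : deriv F = F' := funext fun s => (h1 s).deriv
  have hlm : IsLocalMax F 0 := Filter.Eventually.of_forall hmax
  have h0 : deriv F 0 = 0 := hlm.deriv_eq_zero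
  have hmin := isLocalMin_of_deriv_deriv_pos (f := F) (x₀ := 0)
    (by rw [hdF, h2.deriv]; exact hd) h0 (h1 0).continuousAt
  have hc : F =ᶠ[nhds 0] fun _ => F 0 := by
    filter_upwards [hmin] with s hs
    exact le_antisymm (hmax s) hs
  have hc1 : F' =ᶠ[nhds 0] fun _ => 0 := by
    have := hc.deriv
    rw [hdF] at this
    filter_upwards [this] with s hs
    simpa using hs
  have := hc1.deriv_eq
  rw [h2.deriv] at this
  simp at this
  linarith

lemma hess_quad (f : V3 → ℝ) (v x : V3) :
    ∑ i, ∑ j, hess f v i j * x i * x j = fderiv ℝ (fderiv ℝ f) v x x := by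
  have hx : x = ∑ i, x i • esingle i := by
    ext j
    simp [esingle, Fin.sum_univ_three]
    fin_cases j <;> simp
  conv_rhs => rw [hx]
  simp only [hess, iteratedFDeriv_two_apply, Fin.sum_univ_three]
  simp
  ring

lemma hess_max (f : V3 → ℝ) (hf : ContDiff ℝ 2 f) (σ c μ e : ℝ) (v : V3)
    (hmax : ∀ w : V3, σ * (f w - c * Real.exp (-μ * ‖w‖ ^ 2)) - e * (1 + ‖w‖ ^ 2) ≤
      σ * (f v - c * Real.exp (-μ * ‖v‖ ^ 2)) - e * (1 + ‖v‖ ^ 2)) (x : V3) :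
    ∑ i, ∑ j, (σ • hess f v - (σ * c * Real.exp (-μ * ‖v‖ ^ 2)) •
      ((4 * μ ^ 2) • vvm v - (2 * μ) • idm) - (2 * e) • idm) i j * x i * x j ≤ 0 := by
  set b : ℝ := ∑ i, v i * x i with hb
  set m : ℝ := ‖x‖ ^ 2 with hm
  set n : ℝ := ‖v‖ ^ 2 with hn
  have hb' : inner ℝ v x = b := by
    rw [hb, PiLp.inner_apply]
    refine Finset.sum_congr rfl fun i _ => ?_
    simp [mul_comm]
  have hm' : m = ∑ i, x i ^ 2 := EuclideanSpace.real_norm_sq_eq x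
  have hnorm : ∀ s : ℝ, ‖v + s • x‖ ^ 2 = n + 2 * s * b + s ^ 2 * m := by
    intro s
    rw [norm_add_sq_real, inner_smul_right, norm_smul, hb', mul_pow, Real.norm_eq_abs, sq_abs]
    ring
  set P : ℝ → ℝ := fun s => n + 2 * s * b + s ^ 2 * m with hP
  set P' : ℝ → ℝ := fun s => 2 * b + 2 * s * m with hP'
  have dP : ∀ s, HasDerivAt P (P' s) s := by
    intro s
    have h1 := (((hasDerivAt_id s).const_mul 2).mul_const b).const_add n
    have h2 := ((hasDerivAt_id s).pow 2).mul_const m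
    exact (h1.add h2).congr_deriv (by simp [hP'])
  have dP' : ∀ s, HasDerivAt P' (2 * m) s := by
    intro s
    have h1 := (((hasDerivAt_id s).const_mul 2).mul_const m).const_add (2 * b)
    exact h1.congr_deriv (by simp)
  have dE : ∀ s, HasDerivAt (fun s => Real.exp (-μ * P s)) (Real.exp (-μ * P s) * (-μ * P' s)) s :=
    fun s => ((dP s).const_mul (-μ)).exp
  have dl : ∀ s : ℝ, HasDerivAt (fun s : ℝ => v + s • x) x s := by
    intro s
    simpa using ((hasDerivAt_id s).smul_const x).const_add v
  have hd1 : Differentiable ℝ f := hf.differentiable (by norm_num)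
  have hd2 : Differentiable ℝ (fderiv ℝ f) :=
    (hf.fderiv_right (m := 1) (by norm_num)).differentiable (by norm_num)
  have dg : ∀ s : ℝ, HasDerivAt (fun s : ℝ => f (v + s • x)) (fderiv ℝ f (v + s • x) x) s :=
    fun s => (hd1 _).hasFDerivAt.comp_hasDerivAt s (dl s)
  have dg' : HasDerivAt (fun s : ℝ => fderiv ℝ f (v + s • x) x) (fderiv ℝ (fderiv ℝ f) v x x) 0 := by
    have h0 : HasDerivAt (fun s : ℝ => fderiv ℝ f (v + s • x)) (fderiv ℝ (fderiv ℝ f) (v + (0:ℝ) • x) x) 0 :=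
      (hd2 _).hasFDerivAt.comp_hasDerivAt (0:ℝ) (dl 0)
    have := h0.clm_apply (hasDerivAt_const (0:ℝ) x)
    simpa using this
  have key := sec_test (fun s => σ * (f (v + s • x) - c * Real.exp (-μ * P s)) - e * (1 + P s))
    (fun s => σ * (fderiv ℝ f (v + s • x) x - c * (Real.exp (-μ * P s) * (-μ * P' s))) - e * P' s)
    _ (fun s => (((dg s).sub ((dE s).const_mul c)).const_mul σ).sub (((dP s).const_add 1).const_mul e))
    (((dg'.sub (((dE 0).mul ((dP' 0).const_mul (-μ))).const_mul c)).const_mul σ).sub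
      ((dP' 0).const_mul e))
    (by
      intro s
      have h := hmax (v + s • x)
      rw [hnorm s] at h
      simpa [hP] using h)
  have e1 : ∑ i, ∑ j, (σ • hess f v - (σ * c * Real.exp (-μ * n)) •
      ((4 * μ ^ 2) • vvm v - (2 * μ) • idm) - (2 * e) • idm) i j * x i * x j
      = σ * (∑ i, ∑ j, hess f v i j * x i * x j) - (σ * c * Real.exp (-μ * n)) *
        (4 * μ ^ 2 * b ^ 2 - 2 * μ * m) - 2 * e * m := by
    rw [hb, hm']
    simp [Fin.sum_univ_three, vvm, idm]
    ring
  rw [e1, hess_quad]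
  have hP0 : P 0 = n := by simp [hP]
  have hP0' : P' 0 = 2 * b := by simp [hP']
  rw [hP0, hP0'] at key
  linarith

lemma deriv_test (U : ℝ → ℝ) (T t d : ℝ) (ht : t ∈ Set.Ioc 0 T)
    (hU : HasDerivWithinAt U d (Set.Ioc 0 T) t) (hmax : ∀ s ∈ Set.Ioc 0 T, U s ≤ U t) : 0 ≤ d := by
  have hm : IsLocalMaxOn U (Set.Ioc 0 T) t := by
    refine Filter.eventually_of_mem self_mem_nhdsWithin hmax
  have hy : (t / 2 - t) ∈ posTangentConeAt (Set.Ioc 0 T) t := by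
    apply sub_mem_posTangentConeAt_of_segment_subset
    apply (convex_Ioc 0 T).segment_subset ht
    constructor <;> linarith [ht.1, ht.2]
  have := hm.hasFDerivWithinAt_nonpos hU.hasFDerivWithinAt hy
  simp at this
  nlinarith [ht.1]

lemma comparison (γ T μ σ A α C : ℝ) (hC : 0 ≤ C) (g : ℝ → V3 → ℝ)
    (hcont : ContinuousOn (fun q : ℝ × V3 => g q.1 q.2) (Set.Icc (0 : ℝ) T ×ˢ Set.univ))
    (htime : ∀ v, ContDiffOn ℝ 1 (fun s => g s v) (Set.Ioc (0 : ℝ) T))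
    (hvel : ∀ t ∈ Set.Ioc (0 : ℝ) T, ContDiff ℝ 2 (g t))
    (heqn : ∀ t ∈ Set.Ioc (0 : ℝ) T, ∀ v,
      derivWithin (fun s => g s v) (Set.Ioc (0 : ℝ) T) t =
        matDot (abar γ (g t) v) (hess (g t) v) + cbar γ (g t) v * g t v)
    (hpsd : ∀ t ∈ Set.Ioc (0 : ℝ) T, ∀ v, ∀ H : Mat3,
      (∀ x : V3, ∑ i, ∑ j, H i j * x i * x j ≤ 0) → matDot (abar γ (g t) v) H ≤ 0)
    (htr : ∀ t ∈ Set.Ioc (0 : ℝ) T, ∀ v, matDot (abar γ (g t) v) idm ≤ C)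
    (hc : ∀ t ∈ Set.Ioc (0 : ℝ) T, ∀ v, cbar γ (g t) v ≤ C)
    (hsign : ∀ t ∈ Set.Ioc (0 : ℝ) T, ∀ v, 0 ≤ σ * (α - (4 * μ ^ 2 * matDot (abar γ (g t) v) (vvm v)
      - 2 * μ * matDot (abar γ (g t) v) idm + cbar γ (g t) v)))
    (hA : 0 ≤ A)
    (M : ℝ) (hM : ∀ t ∈ Set.Icc (0 : ℝ) T, ∀ v,
      σ * (g t v - A * Real.exp (α * t) * Real.exp (-μ * ‖v‖ ^ 2)) ≤ M)
    (h0 : ∀ v, σ * (g 0 v - A * Real.exp (-μ * ‖v‖ ^ 2)) ≤ 0) :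
    ∀ t ∈ Set.Icc (0 : ℝ) T, ∀ v,
      σ * (g t v - A * Real.exp (α * t) * Real.exp (-μ * ‖v‖ ^ 2)) ≤ 0 := by
  intro t1 ht1 v1
  by_contra hcon
  push Not at hcon
  set h : ℝ → V3 → ℝ := fun t v =>
    σ * (g t v - A * Real.exp (α * t) * Real.exp (-μ * ‖v‖ ^ 2)) with hh
  set lam : ℝ := 3 * C + 1 with hlam
  have hlam0 : 0 < lam := by linarith
  have hpos1 : 0 < Real.exp (-lam * t1) * h t1 v1 := mul_pos (Real.exp_pos _) hcon
  set ε : ℝ := Real.exp (-lam * t1) * h t1 v1 / (2 * (1 + ‖v1‖ ^ 2)) with hε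
  have hε0 : 0 < ε := by positivity
  set u : ℝ → V3 → ℝ := fun t v => Real.exp (-lam * t) * h t v - ε * (1 + ‖v‖ ^ 2) with hu
  have hu1 : 0 < u t1 v1 := by
    have : ε * (1 + ‖v1‖ ^ 2) = Real.exp (-lam * t1) * h t1 v1 / 2 := by
      rw [hε]; field_simp
    simp only [hu, this]; linarith
  have hM0 : 0 < M := lt_of_lt_of_le hcon (hM t1 ht1 v1)
  -- outside a ball u is nonpositive
  set R : ℝ := max (Real.sqrt (M / ε)) ‖v1‖ with hR
  have hout : ∀ t ∈ Set.Icc (0:ℝ) T, ∀ v : V3, R < ‖v‖ → u t v ≤ 0 := by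
    intro t ht v hv
    have h1 : Real.sqrt (M / ε) < ‖v‖ := lt_of_le_of_lt (le_max_left _ _) hv
    have h2 : M / ε < ‖v‖ ^ 2 := by
      rwa [Real.sqrt_lt' (lt_of_le_of_lt (Real.sqrt_nonneg _) h1)] at h1
    rw [div_lt_iff₀ hε0] at h2
    have h3 : Real.exp (-lam * t) ≤ 1 := by
      rw [Real.exp_le_one_iff]; nlinarith [ht.1]
    have h4 : Real.exp (-lam * t) * h t v ≤ M := by
      have := mul_le_mul_of_nonneg_left (hM t ht v) (Real.exp_pos (-lam * t)).le
      have h5 := mul_le_mul_of_nonneg_right h3 hM0.le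
      simp only [hh]
      linarith
    simp only [hu]
    nlinarith
  have hcu : ContinuousOn (fun q : ℝ × V3 => u q.1 q.2)
      (Set.Icc (0:ℝ) T ×ˢ Metric.closedBall (0:V3) R) := by
    have hg' := hcont.mono (Set.prod_mono (le_refl (Set.Icc (0:ℝ) T))
      (Set.subset_univ (Metric.closedBall (0:V3) R)))
    simp only [hu, hh]
    have e1 : Continuous (fun q : ℝ × V3 => Real.exp (-lam * q.1)) := by fun_prop
    have e2 : Continuous (fun q : ℝ × V3 => A * Real.exp (α * q.1) * Real.exp (-μ * ‖q.2‖ ^ 2)) := by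
      fun_prop
    have e3 : Continuous (fun q : ℝ × V3 => ε * (1 + ‖q.2‖ ^ 2)) := by fun_prop
    exact (e1.continuousOn.mul (continuousOn_const.mul (hg'.sub e2.continuousOn))).sub e3.continuousOn
  have hcomp : IsCompact (Set.Icc (0:ℝ) T ×ˢ Metric.closedBall (0:V3) R) :=
    isCompact_Icc.prod (isCompact_closedBall _ _)
  have hmem1 : (t1, v1) ∈ Set.Icc (0:ℝ) T ×ˢ Metric.closedBall (0:V3) R := by
    refine ⟨ht1, ?_⟩
    simp [hR]
  obtain ⟨⟨t, v⟩, ⟨ht, hv⟩, hmax⟩ := hcomp.exists_isMaxOn ⟨_, hmem1⟩ hcu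
  simp only at ht hv
  have hut : 0 < u t v := lt_of_lt_of_le hu1 (hmax hmem1)
  have hgmax : ∀ s ∈ Set.Icc (0:ℝ) T, ∀ w, u s w ≤ u t v := by
    intro s hs w
    by_cases hw : R < ‖w‖
    · exact (hout s hs w hw).trans hut.le
    · exact hmax (show (s, w) ∈ _ from ⟨hs, by simpa using hw⟩)
  have ht0 : t ≠ 0 := by
    rintro rfl
    have := h0 v
    have hh0 : h 0 v ≤ 0 := by simpa [hh] using this
    have : u 0 v = h 0 v - ε * (1 + ‖v‖ ^ 2) := by simp [hu]
    have : 0 < ε * (1 + ‖v‖ ^ 2) := by positivity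
    linarith
  have ht' : t ∈ Set.Ioc 0 T := ⟨lt_of_le_of_ne ht.1 (Ne.symm ht0), ht.2⟩
  set el := Real.exp (-lam * t) with hel
  have hel0 : 0 < el := Real.exp_pos _
  -- Hessian
  have hH := hess_max (g t) (hvel t ht') σ (A * Real.exp (α * t)) μ (ε / el) v (by
    intro w
    have h1 := hgmax t ht w
    simp only [hu, hh] at h1
    rw [← hel] at h1
    have h2 := div_le_div_of_nonneg_right h1 hel0.le
    rw [sub_div, sub_div, mul_div_cancel_left₀ _ hel0.ne', mul_div_cancel_left₀ _ hel0.ne'] at h2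
    have e : ∀ y : ℝ, ε / el * y = ε * y / el := fun y => by ring
    rw [e, e]
    exact h2)
  have hP := hpsd t ht' v _ hH
  rw [matDot_sub, matDot_sub, matDot_smul, matDot_smul, matDot_smul, matDot_sub, matDot_smul,
    matDot_smul] at hP
  -- time
  set E := Real.exp (-μ * ‖v‖ ^ 2) with hE
  have hE0 : 0 < E := Real.exp_pos _
  set ea := Real.exp (α * t) with hea
  have hea0 : 0 < ea := Real.exp_pos _
  have hdg : HasDerivWithinAt (fun s => g s v) (derivWithin (fun s => g s v) (Set.Ioc 0 T) t)
      (Set.Ioc 0 T) t :=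
    (((htime v).differentiableOn (by norm_num)) t ht').hasDerivWithinAt
  rw [heqn t ht' v] at hdg
  have dl : HasDerivAt (fun s : ℝ => Real.exp (-lam * s)) (el * (-lam * 1)) t :=
    ((hasDerivAt_id t).const_mul (-lam)).exp
  have da : HasDerivAt (fun s : ℝ => A * Real.exp (α * s) * E) (A * (ea * (α * 1)) * E) t :=
    ((((hasDerivAt_id t).const_mul α).exp).const_mul A).mul_const E
  have dU := dl.hasDerivWithinAt.mul ((hdg.sub da.hasDerivWithinAt).const_mul σ)
  have hD := deriv_test _ T t _ ht' dU (by
    intro s hs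
    have := hgmax s ⟨hs.1.le, hs.2⟩ v
    simp only [hu, hh] at this
    simp only [Pi.mul_apply, Pi.sub_apply]
    linarith)
  simp only [Pi.sub_apply] at hD
  rw [← hel, ← hea] at hD
  have hS := hsign t ht' v
  have hTr := htr t ht' v
  have hcb := hc t ht' v
  have hut' : ε < el * (σ * (g t v - A * ea * E)) := by
    have : ε * (1 + ‖v‖ ^ 2) < el * (σ * (g t v - A * ea * E)) := by
      simp only [hu, hh] at hut
      linarith
    nlinarith [sq_nonneg ‖v‖]
  generalize matDot (abar γ (g t) v) (hess (g t) v) = L at *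
  generalize matDot (abar γ (g t) v) (vvm v) = Q at *
  generalize matDot (abar γ (g t) v) idm = Tr at *
  generalize cbar γ (g t) v = c at *
  have hS' := mul_nonneg (mul_nonneg (mul_nonneg hel0.le hA) (mul_nonneg hea0.le hE0.le)) hS
  have hP' := mul_le_mul_of_nonneg_left hP hel0.le
  have hq : el * (ε / el) = ε := by field_simp
  have k1 : (lam - c) * ε ≤ (lam - c) * (el * (σ * (g t v - A * ea * E))) :=
    mul_le_mul_of_nonneg_left hut'.le (by linarith)
  have k2 : ε * Tr ≤ ε * C := mul_le_mul_of_nonneg_left hTr hε0.le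
  have k3 : c * ε ≤ C * ε := mul_le_mul_of_nonneg_right hcb hε0.le
  have k4 : el * (2 * (ε / el) * Tr) = 2 * ε * Tr := by
    rw [← hq]; field_simp
  have k5 : el * (σ * L - σ * (A * ea) * E * (4 * μ ^ 2 * Q - 2 * μ * Tr) - 2 * (ε / el) * Tr) =
      el * (σ * L - σ * (A * ea) * E * (4 * μ ^ 2 * Q - 2 * μ * Tr)) - 2 * ε * Tr := by
    rw [← k4]; ring
  rw [k5] at hP'
  nlinarith

/-- propagation of Maxwellian bounds (Proposition 3 of the paper). -/
theorem propagation_of_maxwellian_bounds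
    (γ : ℝ) (hγ : γ ∈ Set.Icc (-3 : ℝ) (-2)) (T : ℝ) (hT : 0 < T)
    (μ k K : ℝ) (hμ : 0 < μ) (hk : 0 < k) (hK : 0 < K)
    (g : ℝ → V3 → ℝ)
    (hpos : ∀ t ∈ Set.Icc (0 : ℝ) T, ∀ v, 0 < g t v)
    (hcont : ContinuousOn (fun q : ℝ × V3 => g q.1 q.2) (Set.Icc (0 : ℝ) T ×ˢ Set.univ))
    (htime : ∀ v, ContDiffOn ℝ 1 (fun s => g s v) (Set.Ioc (0 : ℝ) T))
    (hvel : ∀ t ∈ Set.Ioc (0 : ℝ) T, ContDiff ℝ 2 (g t))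
    -- g solves the parabolic-form Landau equation on (0,T] × ℝ³
    (heqn : ∀ t ∈ Set.Ioc (0 : ℝ) T, ∀ v,
      derivWithin (fun s => g s v) (Set.Ioc (0 : ℝ) T) t =
        matDot (abar γ (g t) v) (hess (g t) v) + cbar γ (g t) v * g t v)
    (hint : ∀ t ∈ Set.Icc (0 : ℝ) T, Integrable (g t))
    (hmass : ∀ t ∈ Set.Icc (0 : ℝ) T, (∫ v, g t v) = 1)
    (hbdd : ∃ B : ℝ, ∀ t ∈ Set.Icc (0 : ℝ) T, ∀ v, g t v ≤ B)
    (hmom : ∃ Mp : ℝ, ∀ t ∈ Set.Icc (0 : ℝ) T,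
      Integrable (fun v => jap v ^ (γ * (γ + 2) / (γ + 5) - γ) * g t v) ∧
      (∫ v, jap v ^ (γ * (γ + 2) / (γ + 5) - γ) * g t v) ≤ Mp)
    (hinit : ∀ v : V3, k * Real.exp (-μ * ‖v‖ ^ 2) ≤ g 0 v ∧
      g 0 v ≤ K * Real.exp (-μ * ‖v‖ ^ 2)) :
    ∃ k' K' : ℝ, 0 < k' ∧ 0 < K' ∧
      ∀ t ∈ Set.Icc (0 : ℝ) T, ∀ v : V3,
        k' * Real.exp (-μ * ‖v‖ ^ 2) ≤ g t v ∧
        g t v ≤ K' * Real.exp (-μ * ‖v‖ ^ 2) := by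
  obtain ⟨B, hB⟩ := hbdd
  obtain ⟨Mp, hMp⟩ := hmom
  obtain ⟨C, hC, hco⟩ := coeff_bounds γ B Mp hγ
  have sub : ∀ t ∈ Set.Ioc (0 : ℝ) T, t ∈ Set.Icc (0 : ℝ) T := fun t ht => ⟨ht.1.le, ht.2⟩
  have hc := fun t (ht : t ∈ Set.Ioc (0 : ℝ) T) => hco (g t) (hpos t (sub t ht)) (hB t (sub t ht))
    (hint t (sub t ht)) (hmass t (sub t ht)) (hMp t (sub t ht)).1 (hMp t (sub t ht)).2
  set D : ℝ := 4 * μ ^ 2 * C + 2 * μ * C + C with hD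
  have hD0 : 0 ≤ D := by positivity
  have hup := comparison γ T μ 1 K D C hC g hcont htime hvel heqn
    (fun t ht v => (hc t ht v).1) (fun t ht v => (hc t ht v).2.1)
    (fun t ht v => (hc t ht v).2.2.2.2.2.2)
    (by
      intro t ht v
      obtain ⟨-, h1, h2, h3, h4, h5, h6⟩ := hc t ht v
      have e1 := mul_le_mul_of_nonneg_left h3 (show 0 ≤ 4 * μ ^ 2 by positivity)
      have e2 := mul_nonneg (show 0 ≤ 2 * μ by positivity) h2
      have e3 : 0 ≤ 2 * μ * C := by positivity
      linarith)
    hK.le B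
    (by
      intro t ht v
      have := hB t ht v
      have e : 0 < K * Real.exp (D * t) * Real.exp (-μ * ‖v‖ ^ 2) := by positivity
      linarith)
    (by
      intro v
      have := (hinit v).2
      linarith)
  have hlow := comparison γ T μ (-1) k (-D) C hC g hcont htime hvel heqn
    (fun t ht v => (hc t ht v).1) (fun t ht v => (hc t ht v).2.1)
    (fun t ht v => (hc t ht v).2.2.2.2.2.2)
    (by
      intro t ht v
      obtain ⟨-, h1, h2, h3, h4, h5, h6⟩ := hc t ht v
      have e1 := mul_nonneg (show 0 ≤ 4 * μ ^ 2 by positivity) h4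
      have e2 := mul_le_mul_of_nonneg_left h1 (show 0 ≤ 2 * μ by positivity)
      have e3 : 0 ≤ 4 * μ ^ 2 * C := by positivity
      linarith)
    hk.le k
    (by
      intro t ht v
      have h1 := hpos t ht v
      have e1 : Real.exp (-D * t) ≤ 1 := by
        rw [Real.exp_le_one_iff]; nlinarith [ht.1]
      have e2 : Real.exp (-μ * ‖v‖ ^ 2) ≤ 1 := by
        rw [Real.exp_le_one_iff]; nlinarith [sq_nonneg ‖v‖]
      have e3 : Real.exp (-D * t) * Real.exp (-μ * ‖v‖ ^ 2) ≤ 1 :=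
        mul_le_one₀ e1 (Real.exp_pos _).le e2
      have e4 := mul_le_mul_of_nonneg_left e3 hk.le
      linarith)
    (by
      intro v
      have := (hinit v).1
      linarith)
  refine ⟨k * Real.exp (-D * T), K * Real.exp (D * T), by positivity, by positivity, ?_⟩
  intro t ht v
  have hu := hup t ht v
  have hl := hlow t ht v
  have hE : 0 < Real.exp (-μ * ‖v‖ ^ 2) := Real.exp_pos _
  constructor
  · have e1 : Real.exp (-D * T) ≤ Real.exp (-D * t) := by
      apply Real.exp_le_exp.mpr; nlinarith [ht.2]
    have e2 := mul_le_mul_of_nonneg_right (mul_le_mul_of_nonneg_left e1 hk.le) hE.le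
    linarith
  · have e1 : Real.exp (D * t) ≤ Real.exp (D * T) := by
      apply Real.exp_le_exp.mpr; nlinarith [ht.2]
    have e2 := mul_le_mul_of_nonneg_right (mul_le_mul_of_nonneg_left e1 hK.le) hE.le
    linarith

end
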